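/- Coercivity inequality for the convex part of a singular potential: Let F : [−1,1] → ℝ satisfy F ∈ C([−1,1]) ∩ C²((−1,1)), F'(s) → −∞ as s → −1, F'(s) → ∞ as s → 1, and F'' ≥ −κ for some κ ∈ ℝ, and let F₀(s) := F(s) + (κ/2)s² denote its convex part. Then for every m ∈ (−1,1) there exist constants C₁, C₂ > 0 (depending only on F and m) such that F₀'(s)(s − m) ≥ C₁|F₀'(s)| − C₂ for all s ∈ (−1,1). -/

import Mathlib

open Set Filter

/-- A nondecreasing function on `(-1, 1)` satisfies the coercivity inequality around every interior
point. -/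
lemma MonotoneOn.exists_coercivity {G : ℝ → ℝ} (hG : MonotoneOn G (Ioo (-1) 1)) {m : ℝ}
    (hm : m ∈ Ioo (-1 : ℝ) 1) :
    ∃ C₁ C₂ : ℝ, 0 < C₁ ∧ 0 < C₂ ∧
      ∀ s ∈ Ioo (-1 : ℝ) 1, G s * (s - m) ≥ C₁ * |G s| - C₂ := by
  obtain ⟨hm₁, hm₂⟩ := hm
  set a := (m - 1) / 2 with ha
  set b := (m + 1) / 2 with hb
  have ha' : a ∈ Ioo (-1 : ℝ) 1 := ⟨by linarith, by linarith⟩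
  have hb' : b ∈ Ioo (-1 : ℝ) 1 := ⟨by linarith, by linarith⟩
  set M := |G a| + |G b| with hM
  have hM₀ : 0 ≤ M := by positivity
  set δ := min (m - a) (b - m) with hδ
  have hδa : δ ≤ m - a := min_le_left _ _
  have hδb : δ ≤ b - m := min_le_right _ _
  have hδ₀ : 0 < δ := lt_min (by linarith) (by linarith)
  have hGa := neg_abs_le (G a)
  have hGa' := le_abs_self (G a)
  have hGb := neg_abs_le (G b)
  have hGb' := le_abs_self (G b)
  have hGa₀ := abs_nonneg (G a)
  have hGb₀ := abs_nonneg (G b)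
  refine ⟨δ, 3 * M + 1, hδ₀, by linarith, fun s hs ↦ ?_⟩
  have of_abs_le (h : |G s| ≤ M) : G s * (s - m) ≥ δ * |G s| - (3 * M + 1) := by
    have hsm : |s - m| ≤ 2 := abs_le.2 ⟨by linarith [hs.1], by linarith [hs.2]⟩
    have h₁ : |G s * (s - m)| ≤ M * 2 := by
      rw [abs_mul]
      gcongr
    have h₂ : δ * |G s| ≤ 1 * M := by
      gcongr
      linarith
    linarith [neg_abs_le (G s * (s - m))]
  rcases le_total s a with hsa | has
  · have h := hG hs ha' hsa
    rcases le_total (G s) 0 with h₀ | h₀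
    · rw [abs_of_nonpos h₀]
      nlinarith
    · exact of_abs_le (abs_le.2 ⟨by linarith, by linarith⟩)
  rcases le_total b s with hbs | hsb
  · have h := hG hb' hs hbs
    rcases le_total 0 (G s) with h₀ | h₀
    · rw [abs_of_nonneg h₀]
      nlinarith
    · exact of_abs_le (abs_le.2 ⟨by linarith, by linarith⟩)
  · have h₁ := hG ha' hs has
    have h₂ := hG hs hb' hsb
    exact of_abs_le (abs_le.2 ⟨by linarith, by linarith⟩)

/-- If `F'' ≥ -κ` on an open convex set, then `F + (κ / 2) s²` has nondecreasing derivative. -/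
lemma monotoneOn_deriv_add_sq {F : ℝ → ℝ} {κ : ℝ} {S : Set ℝ} (hS : IsOpen S)
    (hconv : Convex ℝ S) (hF : ContDiffOn ℝ 2 F S) (hκ : ∀ s ∈ S, -κ ≤ deriv (deriv F) s) :
    MonotoneOn (deriv fun s ↦ F s + κ / 2 * s ^ 2) S := by
  have hderiv : EqOn (deriv fun s ↦ F s + κ / 2 * s ^ 2) (fun s ↦ deriv F s + κ * s) S := by
    intro s hs
    have hFs := ((hF.differentiableOn (by norm_num)).differentiableAt (hS.mem_nhds hs)).hasDerivAt
    have hsq := ((hasDerivAt_id s).pow 2).const_mul (κ / 2)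
    refine ((hFs.add hsq).congr_deriv ?_).deriv
    simp
    ring
  have hF' : DifferentiableOn ℝ (deriv F) S :=
    (hF.deriv_of_isOpen (m := 1) hS (by norm_num)).differentiableOn (by norm_num)
  have hderiv₂ : ∀ s ∈ S, HasDerivAt (fun s ↦ deriv F s + κ * s) (deriv (deriv F) s + κ) s := by
    intro s hs
    exact ((hF'.differentiableAt (hS.mem_nhds hs)).hasDerivAt.add
      ((hasDerivAt_id s).const_mul κ)).congr_deriv (by simp)
  refine MonotoneOn.congr ?_ hderiv.symm
  refine monotoneOn_of_deriv_nonneg hconv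
    (fun s hs ↦ (hderiv₂ s hs).continuousAt.continuousWithinAt)
    (fun s hs ↦ (hderiv₂ s (interior_subset hs)).differentiableAt.differentiableWithinAt)
    fun s hs ↦ ?_
  rw [(hderiv₂ s (interior_subset hs)).deriv]
  linarith [hκ s (interior_subset hs)]

/-- **Coercivity inequality for the convex part of a singular potential.**
Let `F : [−1,1] → ℝ` be `C⁰` on `[−1,1]`, `C²` on `(−1,1)`, with `F'(s) → −∞` as `s → −1`,
`F'(s) → ∞` as `s → 1`, and `F'' ≥ −κ`.  Let `F₀ s = F s + (κ/2) s²` be its convex part.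
Then for every `m ∈ (−1,1)` there are constants `C₁, C₂ > 0` (depending only on `F` and `m`)
such that `F₀'(s)(s − m) ≥ C₁ |F₀'(s)| − C₂` for all `s ∈ (−1,1)`. -/
theorem coercivity_convex_part_singular_potential
    (F : ℝ → ℝ) (κ : ℝ)
    (hFc : ContinuousOn F (Icc (-1) 1))
    (hFC2 : ContDiffOn ℝ 2 F (Ioo (-1) 1))
    (hFbot : Tendsto (deriv F) (nhdsWithin (-1) (Ioo (-1) 1)) atBot)
    (hFtop : Tendsto (deriv F) (nhdsWithin 1 (Ioo (-1) 1)) atTop)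
    (hFκ : ∀ s ∈ Ioo (-1:ℝ) 1, -κ ≤ deriv (deriv F) s)
    (F₀ : ℝ → ℝ) (hF₀ : ∀ s, F₀ s = F s + κ / 2 * s ^ 2) :
    ∀ m ∈ Ioo (-1:ℝ) 1, ∃ C₁ C₂ : ℝ, 0 < C₁ ∧ 0 < C₂ ∧
      ∀ s ∈ Ioo (-1:ℝ) 1, deriv F₀ s * (s - m) ≥ C₁ * |deriv F₀ s| - C₂ := by
  obtain rfl : F₀ = fun s ↦ F s + κ / 2 * s ^ 2 := funext hF₀
  exact fun m hm ↦
    (monotoneOn_deriv_add_sq isOpen_Ioo (convex_Ioo _ _) hFC2 hFκ).exists_coercivity hm
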